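/- Every non-negative triangular loop has a poly-exponential closed form: let d ≥ 1, let A ∈ ℤ^{d×d} be lower triangular (A_{ij} = 0 whenever i < j) with A_{ii} ≥ 0 for all i, let a ∈ ℤ^d, and let f : ℤ^d → ℤ^d, f(x) = Ax + a. Then there exist poly-exponential expressions q₁,…,q_d : ℤ^d → ℕ → ℚ such that for all x ∈ ℤ^d and all n ∈ ℕ, (q₁(x,n),…,q_d(x,n)) equals fⁿ(x) cast into ℚ^d, where fⁿ is the n-fold iterate of f. -/

import Mathlib

/-- A function `p : ℤ^d → ℕ → ℚ` is a poly-exponential expression if it is a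
finite sum of terms `1_{S_j}(n) · α_j(x) · n^{a_j} · b_j^n` where each `S_j ⊆ ℕ`
is empty, a singleton, or has finite complement, each `α_j` is affine, and
`b_j ≥ 1`. -/
def IsPolyExp {d : ℕ} (p : (Fin d → ℤ) → ℕ → ℚ) : Prop :=
  ∃ (ℓ : ℕ) (S : Fin ℓ → Set ℕ) (v : Fin ℓ → Fin d → ℚ) (w : Fin ℓ → ℚ)
    (a : Fin ℓ → ℕ) (b : Fin ℓ → ℕ),
    (∀ j, S j = ∅ ∨ (∃ c : ℕ, S j = {c}) ∨ (S j)ᶜ.Finite) ∧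
    (∀ j, 1 ≤ b j) ∧
    ∀ (x : Fin d → ℤ) (n : ℕ),
      p x n = ∑ j, (S j).indicator (fun _ => (1 : ℚ)) n *
        ((∑ i, v j i * (x i : ℚ)) + w j) * (n : ℚ) ^ a j * (b j : ℚ) ^ n

/-- The space of rational sequences spanned by the sequences `n ^ a * b ^ n` with `b ≥ 1` and the
unit sequences. -/
def polyExpSeq : Submodule ℚ (ℕ → ℚ) :=
  Submodule.span ℚ ({g | ∃ a b : ℕ, 1 ≤ b ∧ g = fun n : ℕ => (n : ℚ) ^ a * (b : ℚ) ^ n} ∪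
    Set.range fun c : ℕ => Pi.single c (1 : ℚ))

theorem pow_mul_pow_mem_polyExpSeq (a : ℕ) {b : ℕ} (hb : 1 ≤ b) :
    (fun n : ℕ => (n : ℚ) ^ a * (b : ℚ) ^ n) ∈ polyExpSeq :=
  Submodule.subset_span (Or.inl ⟨a, b, hb, rfl⟩)

theorem single_mem_polyExpSeq (c : ℕ) : (Pi.single c 1 : ℕ → ℚ) ∈ polyExpSeq :=
  Submodule.subset_span (Or.inr ⟨c, rfl⟩)

theorem const_mem_polyExpSeq (r : ℚ) : (fun _ : ℕ => r) ∈ polyExpSeq := by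
  convert polyExpSeq.smul_mem r (pow_mul_pow_mem_polyExpSeq 0 le_rfl) using 1
  ext n
  simp

theorem geom_mem_polyExpSeq (m : ℕ) : (fun n : ℕ => (m : ℚ) ^ n) ∈ polyExpSeq := by
  rcases Nat.eq_zero_or_pos m with rfl | hm
  · convert single_mem_polyExpSeq 0 using 1
    ext n
    cases n <;> simp
  · simpa using pow_mul_pow_mem_polyExpSeq 0 hm

/-- The operator sending a sequence `h` to `n ↦ h (n + 1) - m * h n`. -/
def shiftSub (m : ℕ) : (ℕ → ℚ) →ₗ[ℚ] (ℕ → ℚ) :=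
  LinearMap.funLeft ℚ ℚ Nat.succ - (m : ℚ) • LinearMap.id

theorem shiftSub_apply (m : ℕ) (h : ℕ → ℚ) (n : ℕ) :
    shiftSub m h n = h (n + 1) - m * h n := by
  simp [shiftSub, LinearMap.funLeft_apply]

theorem shiftSub_single_zero (m : ℕ) :
    shiftSub m (Pi.single 0 1) = -(m : ℚ) • Pi.single 0 1 := by
  ext n
  cases n <;> simp [shiftSub_apply]

theorem shiftSub_single_succ (m c : ℕ) :
    shiftSub m (Pi.single (c + 1) 1) = Pi.single c 1 - (m : ℚ) • Pi.single (c + 1) 1 := by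
  ext n
  simp [shiftSub_apply, Pi.single_apply]

theorem single_mem_map_shiftSub (m c : ℕ) :
    (Pi.single c 1 : ℕ → ℚ) ∈ polyExpSeq.map (shiftSub m) := by
  have hmap (c : ℕ) := Submodule.mem_map_of_mem (f := shiftSub m) (single_mem_polyExpSeq c)
  rcases Nat.eq_zero_or_pos m with rfl | hm
  · simpa [shiftSub_single_succ] using hmap (c + 1)
  · have hm' : (m : ℚ) ≠ 0 := by positivity
    rw [← Submodule.smul_mem_iff _ hm']
    induction c with
    | zero => simpa [shiftSub_single_zero] using hmap 0
    | succ c ih =>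
      rw [Submodule.smul_mem_iff _ hm'] at ih
      simpa [shiftSub_single_succ] using Submodule.sub_mem _ ih (hmap (c + 1))

theorem shiftSub_pow_mul_pow (m a b : ℕ) :
    shiftSub m (fun n => (n : ℚ) ^ a * (b : ℚ) ^ n) =
      ((b : ℚ) - m) • (fun n : ℕ => (n : ℚ) ^ a * (b : ℚ) ^ n) +
        ∑ k ∈ Finset.range a,
          ((b : ℚ) * a.choose k) • (fun n : ℕ => (n : ℚ) ^ k * (b : ℚ) ^ n) := by
  ext n
  simp only [shiftSub_apply, Pi.add_apply, Pi.smul_apply, Finset.sum_apply, smul_eq_mul]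
  push_cast
  rw [add_pow, Finset.sum_range_succ]
  simp only [one_pow, mul_one, Nat.choose_self, Nat.cast_one]
  have : ∑ k ∈ Finset.range a, (b : ℚ) * a.choose k * ((n : ℚ) ^ k * (b : ℚ) ^ n) =
      (∑ k ∈ Finset.range a, (n : ℚ) ^ k * a.choose k) * (b : ℚ) ^ (n + 1) := by
    rw [Finset.sum_mul]
    exact Finset.sum_congr rfl fun k _ => by ring
  rw [this]
  ring

theorem pow_mul_pow_mem_map_shiftSub (m a : ℕ) {b : ℕ} (hb : 1 ≤ b) :
    (fun n : ℕ => (n : ℚ) ^ a * (b : ℚ) ^ n) ∈ polyExpSeq.map (shiftSub m) := by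
  have hmap (a : ℕ) := Submodule.mem_map_of_mem (f := shiftSub m) (pow_mul_pow_mem_polyExpSeq a hb)
  simp only [shiftSub_pow_mul_pow] at hmap
  induction a using Nat.strong_induction_on with
  | _ a ih =>
    have hlow (c : ℕ → ℚ) : ∑ k ∈ Finset.range a,
        c k • (fun n : ℕ => (n : ℚ) ^ k * (b : ℚ) ^ n) ∈ polyExpSeq.map (shiftSub m) :=
      Submodule.sum_mem _ fun k hk => Submodule.smul_mem _ _ (ih k (Finset.mem_range.1 hk))
    by_cases hbm : b = m
    · subst hbm
      have h := hmap (a + 1)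
      rw [Finset.sum_range_succ, sub_self, zero_smul, zero_add,
        Submodule.add_mem_iff_right _ (hlow _), Submodule.smul_mem_iff] at h
      · exact h
      · rw [Nat.choose_succ_self_right]
        positivity
    · have h := hmap a
      rwa [Submodule.add_mem_iff_left _ (hlow _), Submodule.smul_mem_iff] at h
      rw [sub_ne_zero]
      exact_mod_cast hbm

theorem polyExpSeq_le_map_shiftSub (m : ℕ) : polyExpSeq ≤ polyExpSeq.map (shiftSub m) := by
  refine Submodule.span_le.2 ?_
  rintro g (⟨a, b, hb, rfl⟩ | ⟨c, rfl⟩)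
  · exact pow_mul_pow_mem_map_shiftSub m a hb
  · exact single_mem_map_shiftSub m c

theorem mem_polyExpSeq_of_recurrence {y g : ℕ → ℚ} (m : ℕ) (hg : g ∈ polyExpSeq)
    (hy : ∀ n, y (n + 1) = m * y n + g n) : y ∈ polyExpSeq := by
  obtain ⟨h, hh, rfl⟩ := polyExpSeq_le_map_shiftSub m hg
  have hsol : y = h + (y 0 - h 0) • fun n : ℕ => (m : ℚ) ^ n := by
    ext n
    simp only [Pi.add_apply, Pi.smul_apply, smul_eq_mul]
    induction n with
    | zero => simp
    | succ n ih =>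
      rw [hy, shiftSub_apply, ih]
      ring
  rw [hsol]
  exact polyExpSeq.add_mem hh (polyExpSeq.smul_mem _ (geom_mem_polyExpSeq m))

theorem orbit_mem_polyExpSeq {d : ℕ} {A : Matrix (Fin d) (Fin d) ℤ}
    (hTri : ∀ i j : Fin d, i < j → A i j = 0) (hDiag : ∀ i : Fin d, 0 ≤ A i i)
    {a : Fin d → ℤ} {u : ℕ → Fin d → ℤ} (hu : ∀ n, u (n + 1) = A.mulVec (u n) + a)
    (i : Fin d) : (fun n => (u n i : ℚ)) ∈ polyExpSeq := by
  induction i using WellFoundedLT.induction with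
  | _ i ih =>
    obtain ⟨m, hm⟩ := Int.eq_ofNat_of_zero_le (hDiag i)
    refine mem_polyExpSeq_of_recurrence m
      (g := ∑ j ∈ Finset.univ.erase i, (A i j : ℚ) • (fun n => (u n j : ℚ)) +
        fun _ => (a i : ℚ)) (polyExpSeq.add_mem (polyExpSeq.sum_mem fun j hj => ?_)
        (const_mem_polyExpSeq _)) fun n => ?_
    · rcases lt_or_gt_of_ne (Finset.ne_of_mem_erase hj) with h | h
      · exact polyExpSeq.smul_mem _ (ih j h)
      · simp [hTri i j h]
    · have h := congrFun (hu n) i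
      rw [Pi.add_apply, Matrix.mulVec, dotProduct,
        ← Finset.add_sum_erase _ _ (Finset.mem_univ i), hm] at h
      simp [h, add_assoc]

theorem IsPolyExp.zero {d : ℕ} : IsPolyExp (fun (_ : Fin d → ℤ) (_ : ℕ) => (0 : ℚ)) :=
  ⟨0, Fin.elim0, Fin.elim0, Fin.elim0, Fin.elim0, Fin.elim0, fun j => j.elim0,
    fun j => j.elim0, by simp⟩

theorem IsPolyExp.add {d : ℕ} {p q : (Fin d → ℤ) → ℕ → ℚ} (hp : IsPolyExp p)
    (hq : IsPolyExp q) : IsPolyExp (fun x n => p x n + q x n) := by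
  obtain ⟨l, S, v, w, a, b, hS, hb, h⟩ := hp
  obtain ⟨l', S', v', w', a', b', hS', hb', h'⟩ := hq
  refine ⟨l + l', Fin.append S S', Fin.append v v', Fin.append w w', Fin.append a a',
    Fin.append b b', ?_, ?_, fun x n => ?_⟩
  · intro j
    refine Fin.addCases (fun j => ?_) (fun j => ?_) j
    · simpa using hS j
    · simpa using hS' j
  · intro j
    refine Fin.addCases (fun j => ?_) (fun j => ?_) j
    · simpa using hb j
    · simpa using hb' j
  · simp [Fin.sum_univ_add, h, h']

theorem IsPolyExp.sum {d : ℕ} {ι : Type*} (s : Finset ι) {p : ι → (Fin d → ℤ) → ℕ → ℚ}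
    (hp : ∀ i ∈ s, IsPolyExp (p i)) : IsPolyExp (fun x n => ∑ i ∈ s, p i x n) := by
  classical
  induction s using Finset.induction_on with
  | empty => simpa using IsPolyExp.zero
  | insert i s hi ih =>
    simp only [Finset.sum_insert hi]
    exact (hp i (Finset.mem_insert_self i s)).add
      (ih fun j hj => hp j (Finset.mem_insert_of_mem hj))

theorem isPolyExp_affine_mul {d : ℕ} {g : ℕ → ℚ} (hg : g ∈ polyExpSeq) (v : Fin d → ℚ) (w : ℚ) :
    IsPolyExp (fun (x : Fin d → ℤ) n => (∑ i, v i * (x i : ℚ) + w) * g n) := by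
  induction hg using Submodule.span_induction generalizing v w with
  | mem g hg =>
    rcases hg with ⟨a, b, hb, rfl⟩ | ⟨c, rfl⟩
    · exact ⟨1, fun _ => Set.univ, fun _ => v, fun _ => w, fun _ => a, fun _ => b,
        fun _ => by simp, fun _ => hb, fun x n => by simp [mul_assoc]⟩
    · exact ⟨1, fun _ => {c}, fun _ => v, fun _ => w, fun _ => 0, fun _ => 1,
        fun _ => by simp, fun _ => le_rfl, fun x n => by
          simp [Pi.single_apply, Set.indicator_apply]⟩
  | zero => simpa using IsPolyExp.zero
  | add g h _ _ hg hh =>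
    simpa only [Pi.add_apply, mul_add] using (hg v w).add (hh v w)
  | smul r g _ hg =>
    convert hg (fun i => r * v i) (r * w) using 3 with x n
    simp only [Pi.smul_apply, smul_eq_mul, mul_assoc, ← Finset.mul_sum]
    ring

theorem affine_iterate_eq {d : ℕ} (A : Matrix (Fin d) (Fin d) ℤ) (a x : Fin d → ℤ) (n : ℕ) :
    (fun v => A.mulVec v + a)^[n] x = (A ^ n).mulVec x + (fun v => A.mulVec v + a)^[n] 0 := by
  induction n with
  | zero => simp
  | succ n ih =>
    simp only [Function.iterate_succ_apply', ih, Matrix.mulVec_add, Matrix.mulVec_mulVec,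
      pow_succ', add_assoc]

/-- every non-negative triangular loop (lower triangular update
matrix with non-negative diagonal) has a poly-exponential closed form. -/
theorem nnt_loop_has_closed_form (d : ℕ) (hd : 1 ≤ d)
    (A : Matrix (Fin d) (Fin d) ℤ)
    (hTri : ∀ i j : Fin d, i < j → A i j = 0)
    (hDiag : ∀ i : Fin d, 0 ≤ A i i)
    (a : Fin d → ℤ) :
    ∃ q : Fin d → (Fin d → ℤ) → ℕ → ℚ,
      (∀ i, IsPolyExp (q i)) ∧
      (∀ (x : Fin d → ℤ) (n : ℕ) (i : Fin d),
        q i x n = (((fun v => A.mulVec v + a)^[n] x) i : ℚ)) := by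
  refine ⟨fun i x n => (((fun v => A.mulVec v + a)^[n] x) i : ℚ), fun i => ?_,
    fun _ _ _ => rfl⟩
  have hlin (j : Fin d) : (fun n => ((A ^ n) i j : ℚ)) ∈ polyExpSeq :=
    orbit_mem_polyExpSeq (u := fun n => (A ^ n).col j) (a := 0) hTri hDiag
      (fun n => by ext k; simp [pow_succ', Matrix.mul_apply, Matrix.mulVec, dotProduct]) i
  have hconst : (fun n => (((fun v => A.mulVec v + a)^[n] 0) i : ℚ)) ∈ polyExpSeq :=
    orbit_mem_polyExpSeq hTri hDiag (fun n => Function.iterate_succ_apply' _ n 0) i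
  convert (IsPolyExp.sum Finset.univ fun j _ =>
    isPolyExp_affine_mul (hlin j) (Pi.single j 1) 0).add
      (isPolyExp_affine_mul hconst 0 1) using 3 with x n
  beta_reduce
  rw [affine_iterate_eq A a x]
  simp [Matrix.mulVec, dotProduct, Pi.single_apply, mul_comm]
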